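/- Define χ(m₁,m₂) = -(1/6)·H₂ + (1/2)·H₃ + (1/2)·H₄ + (1/6)·H₆, where H₂, H₃, H₄, H₆ are the traces (as functions of m₁,m₂ described below) of representatives of the torsion conjugacy classes of SL₃(ℤ) with characteristic polynomials (x-1)(x+1)², (x-1)(x²+x+1), (x-1)(x²+1), (x-1)(x²-x+1) on the irreducible SL₃-representation of highest weight (m₁+m₂)ε₁+m₂ε₂. Then: if m₁,m₂ are both even, χ(m₁,m₂) = -1 - d(m₁+2) - d(m₂+2); if m₁ is even and m₂ is odd, χ = -d(m₁+2) + d(m₁+m₂+3); if m₁ is odd and m₂ is even, χ = -d(m₂+2) + d(m₁+m₂+3); if both odd, χ = 0. Here d(2) := -1 and for k > 2, d(k) is the dimension of the space of weight-k cusp forms for SL₂(ℤ). -/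

import Mathlib

/-- `H₂(m₁,m₂)`: the trace of the torsion class with characteristic polynomial
`(x-1)(x+1)²` on the irreducible `SL₃`-representation of highest weight
`(m₁+m₂)ε₁ + m₂ε₂`, as a function of the parities of `m₁, m₂`. -/
def H2 (m₁ m₂ : ℕ) : ℚ :=
  if Even m₁ ∧ Even m₂ then 1 + ((m₁ : ℚ) + m₂) / 2
  else if Even m₁ then -(((m₂ : ℚ) + 1) / 2)
  else if Even m₂ then -(((m₁ : ℚ) + 1) / 2)
  else 0

/-- `H₃`: trace of the torsion class with characteristic polynomial
`(x-1)(x²+x+1)`, a function of `(m₁ mod 3, m₂ mod 3)`. -/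
def H3 (m₁ m₂ : ℕ) : ℤ :=
  ![![1, 0, 0], ![0, -1, 0], ![0, 0, 0]] ⟨m₁ % 3, by omega⟩ ⟨m₂ % 3, by omega⟩

/-- `H₄`: trace of the torsion class with characteristic polynomial
`(x-1)(x²+1)`, a function of `(m₁ mod 4, m₂ mod 4)`. -/
def H4 (m₁ m₂ : ℕ) : ℤ :=
  ![![1, 1, 0, 0], ![1, 0, -1, 0], ![0, -1, -1, 0], ![0, 0, 0, 0]]
    ⟨m₁ % 4, by omega⟩ ⟨m₂ % 4, by omega⟩

/-- `H₆`: trace of the torsion class with characteristic polynomial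
`(x-1)(x²-x+1)`, a function of `(m₁ mod 6, m₂ mod 6)`. -/
def H6 (m₁ m₂ : ℕ) : ℤ :=
  ![![1, 2, 2, 1, 0, 0],
    ![2, 3, 2, 0, -1, 0],
    ![2, 2, 0, -2, -2, 0],
    ![1, 0, -2, -3, -2, 0],
    ![0, -1, -2, -2, -1, 0],
    ![0, 0, 0, 0, 0, 0]] ⟨m₁ % 6, by omega⟩ ⟨m₂ % 6, by omega⟩

/-- `χ(m₁,m₂) = -(1/6)H₂ + (1/2)H₃ + (1/2)H₄ + (1/6)H₆`, the homological Euler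
characteristic of `SL₃(ℤ)` with coefficients in `M_{m₁,m₂}`. -/
def chi (m₁ m₂ : ℕ) : ℚ :=
  -(1 / 6) * H2 m₁ m₂ + (1 / 2) * (H3 m₁ m₂ : ℚ) + (1 / 2) * (H4 m₁ m₂ : ℚ) +
    (1 / 6) * (H6 m₁ m₂ : ℚ)

/-- `d(k)`: the dimension of the space of weight-`k` cusp forms for `SL₂(ℤ)`,
with the convention `d(2) = -1`. -/
noncomputable def d (k : ℕ) : ℤ :=
  if k = 2 then -1
  else Module.finrank ℂ (CuspForm (⊤ : Subgroup (Matrix.SpecialLinearGroup (Fin 2) ℤ)) (k : ℤ))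

/-- The value of `d k` at even `k ≥ 2`, see `d_eq_cuspDim`. -/
def cuspDim (k : ℕ) : ℤ := ((k / 12 : ℕ) : ℤ) - if k % 12 = 2 then 1 else 0

theorem cuspDim_add_twelve_mul (k a : ℕ) : cuspDim (12 * a + k) = a + cuspDim k := by
  rw [cuspDim, cuspDim, Nat.mul_add_mod, Nat.mul_add_div (by norm_num)]
  push_cast
  ring

theorem finrank_cuspForm_congr {Γ Γ' : Subgroup (Matrix.GeneralLinearGroup (Fin 2) ℝ)}
    [Γ.HasDetOne] [Γ'.HasDetOne] (h : Γ = Γ') (k : ℤ) :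
    Module.finrank ℂ (CuspForm Γ k) = Module.finrank ℂ (CuspForm Γ' k) := by
  subst h
  rfl

open scoped MatrixGroups in
theorem finrank_cuspForm_top (k : ℤ) :
    Module.finrank ℂ (CuspForm (⊤ : Subgroup (Matrix.SpecialLinearGroup (Fin 2) ℤ)) k) =
      Module.finrank ℂ (CuspForm 𝒮ℒ k) :=
  finrank_cuspForm_congr (MonoidHom.range_eq_map _).symm k

open scoped MatrixGroups in
theorem d_eq_cuspDim {k : ℕ} (hk : Even k) (hk2 : 2 ≤ k) : d k = cuspDim k := by
  rw [d, cuspDim]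
  rcases hk2.eq_or_lt with rfl | h3
  · simp
  rw [if_neg (by lia), finrank_cuspForm_top]
  have hcusp := (ModularForm.rank_eq_one_add_rank_cuspForm h3 hk).symm.trans
    (ModularForm.dimension_level_one k hk)
  have : FiniteDimensional ℂ (CuspForm 𝒮ℒ (k : ℤ)) :=
    CuspForm.discriminantEquiv.symm.finiteDimensional
  rw [← Module.finrank_eq_rank] at hcusp
  norm_cast at hcusp
  split_ifs at hcusp ⊢ <;> simp only [Nat.ModEq] at * <;> lia

/-- Six times the periodic part of `chi`. -/
def chiPeriodic (m₁ m₂ : ℕ) : ℤ := 3 * H3 m₁ m₂ + 3 * H4 m₁ m₂ + H6 m₁ m₂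

theorem chi_eq (m₁ m₂ : ℕ) : chi m₁ m₂ = (chiPeriodic m₁ m₂ - H2 m₁ m₂) / 6 := by
  rw [chi, chiPeriodic]
  push_cast
  ring

theorem chiPeriodic_add_twelve_mul (a b r s : ℕ) :
    chiPeriodic (12 * a + r) (12 * b + s) = chiPeriodic r s := by
  have h3 (c t : ℕ) : (12 * c + t) % 3 = t % 3 := by lia
  have h4 (c t : ℕ) : (12 * c + t) % 4 = t % 4 := by lia
  have h6 (c t : ℕ) : (12 * c + t) % 6 = t % 6 := by lia
  simp only [chiPeriodic, H3, H4, H6, h3, h4, h6]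

theorem chiPeriodic_comm (m₁ m₂ : ℕ) : chiPeriodic m₁ m₂ = chiPeriodic m₂ m₁ := by
  have key : ∀ r < 12, ∀ s < 12, chiPeriodic r s = chiPeriodic s r := by decide
  rw [← Nat.div_add_mod m₁ 12, ← Nat.div_add_mod m₂ 12, chiPeriodic_add_twelve_mul,
    chiPeriodic_add_twelve_mul]
  exact key _ (Nat.mod_lt _ (by norm_num)) _ (Nat.mod_lt _ (by norm_num))

theorem chiPeriodic_even_even {m₁ m₂ : ℕ} (h₁ : Even m₁) (h₂ : Even m₂) :
    2 * chiPeriodic m₁ m₂ =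
      m₁ + m₂ - 10 - 12 * cuspDim (m₁ + 2) - 12 * cuspDim (m₂ + 2) := by
  have key : ∀ r < 12, ∀ s < 12, Even r → Even s → 2 * chiPeriodic r s =
      r + s - 10 - 12 * cuspDim (r + 2) - 12 * cuspDim (s + 2) := by decide
  have h := key (m₁ % 12) (by lia) (m₂ % 12) (by lia) (by grind) (by grind)
  rw [← Nat.div_add_mod m₁ 12, ← Nat.div_add_mod m₂ 12, chiPeriodic_add_twelve_mul, h,
    add_assoc, add_assoc, cuspDim_add_twelve_mul, cuspDim_add_twelve_mul]
  push_cast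
  ring

theorem chiPeriodic_even_odd {m₁ m₂ : ℕ} (h₁ : Even m₁) (h₂ : Odd m₂) :
    2 * chiPeriodic m₁ m₂ =
      -(m₂ + 1) - 12 * cuspDim (m₁ + 2) + 12 * cuspDim (m₁ + m₂ + 3) := by
  have key : ∀ r < 12, ∀ s < 12, Even r → Odd s → 2 * chiPeriodic r s =
      -(s + 1) - 12 * cuspDim (r + 2) + 12 * cuspDim (r + s + 3) := by decide
  have h := key (m₁ % 12) (by lia) (m₂ % 12) (by lia) (by grind) (by grind)
  have e : 12 * (m₁ / 12) + m₁ % 12 + (12 * (m₂ / 12) + m₂ % 12) + 3 =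
      12 * (m₁ / 12 + m₂ / 12) + (m₁ % 12 + m₂ % 12 + 3) := by ring
  rw [← Nat.div_add_mod m₁ 12, ← Nat.div_add_mod m₂ 12, chiPeriodic_add_twelve_mul, h, e,
    add_assoc _ _ 2, cuspDim_add_twelve_mul, cuspDim_add_twelve_mul]
  push_cast
  ring

theorem chiPeriodic_odd_odd {m₁ m₂ : ℕ} (h₁ : Odd m₁) (h₂ : Odd m₂) :
    chiPeriodic m₁ m₂ = 0 := by
  have key : ∀ r < 12, ∀ s < 12, Odd r → Odd s → chiPeriodic r s = 0 := by decide
  rw [← Nat.div_add_mod m₁ 12, ← Nat.div_add_mod m₂ 12, chiPeriodic_add_twelve_mul]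
  exact key _ (by lia) _ (by lia) (by grind) (by grind)

/-- the values of `χ(m₁,m₂)` in terms of dimensions of spaces of
cusp forms, according to the parities of `m₁` and `m₂`. -/
theorem stmt16 (m₁ m₂ : ℕ) :
    (Even m₁ → Even m₂ → chi m₁ m₂ = -1 - (d (m₁ + 2) : ℚ) - (d (m₂ + 2) : ℚ)) ∧
    (Even m₁ → Odd m₂ → chi m₁ m₂ = -(d (m₁ + 2) : ℚ) + (d (m₁ + m₂ + 3) : ℚ)) ∧
    (Odd m₁ → Even m₂ → chi m₁ m₂ = -(d (m₂ + 2) : ℚ) + (d (m₁ + m₂ + 3) : ℚ)) ∧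
    (Odd m₁ → Odd m₂ → chi m₁ m₂ = 0) := by
  refine ⟨fun h₁ h₂ => ?_, fun h₁ h₂ => ?_, fun h₁ h₂ => ?_, fun h₁ h₂ => ?_⟩
  · have h := congrArg (Int.cast : ℤ → ℚ) (chiPeriodic_even_even h₁ h₂)
    push_cast at h
    rw [chi_eq, d_eq_cuspDim (by grind) (by lia), d_eq_cuspDim (by grind) (by lia), H2,
      if_pos ⟨h₁, h₂⟩]
    linarith
  · have h := congrArg (Int.cast : ℤ → ℚ) (chiPeriodic_even_odd h₁ h₂)
    push_cast at h
    rw [chi_eq, d_eq_cuspDim (by grind) (by lia), d_eq_cuspDim (by grind) (by lia), H2,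
      if_neg (by grind), if_pos h₁]
    linarith
  · have h := congrArg (Int.cast : ℤ → ℚ) (chiPeriodic_even_odd h₂ h₁)
    push_cast at h
    rw [chi_eq, chiPeriodic_comm, add_comm m₁ m₂, d_eq_cuspDim (by grind) (by lia),
      d_eq_cuspDim (by grind) (by lia), H2, if_neg (by grind), if_neg (by grind), if_pos h₂]
    linarith
  · rw [chi_eq, chiPeriodic_odd_odd h₁ h₂, H2, if_neg (by grind), if_neg (by grind),
      if_neg (by grind)]
    norm_num
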